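/- arXiv:1201.3431 — 2 statements merged into one kernel-verified Lean document; each statement's English description precedes it below -/
import Mathlib

section
/- One-dimensional optimal system: for every nonzero vector c = (c₁, c₂, c₃) ∈ ℝ³ there exist a finite composition F of adjoint maps from the families A_ε, B_ε, C_ε and a nonzero scalar μ such that μ·F(c) equals either (1, a, 0) for some a ∈ ℝ, or (b, 1, 0) for some b ∈ ℝ, or (0, 0, 1). Hence every one-dimensional subalgebra of the symmetry algebra of the SPE is equivalent under the adjoint representation and rescaling to one spanned by v₁ + a·v₂, or b·v₁ + v₂, or v₃. -/
/-- Adjoint action of `exp(ε v₁)` on `𝔤 ≅ ℝ³`: `A_ε(c₁,c₂,c₃) = (c₁+εc₃, c₂, c₃)`. -/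
def Aad (ε : ℝ) : ℝ × ℝ × ℝ → ℝ × ℝ × ℝ := fun c => (c.1 + ε * c.2.2, c.2.1, c.2.2)

/-- Adjoint action of `exp(ε v₂)`: `B_ε(c₁,c₂,c₃) = (c₁, c₂+εc₃, c₃)`. -/
def Bad (ε : ℝ) : ℝ × ℝ × ℝ → ℝ × ℝ × ℝ := fun c => (c.1, c.2.1 + ε * c.2.2, c.2.2)

/-- Adjoint action of `exp(ε v₃)`: `C_ε(c₁,c₂,c₃) = (e^{−ε}c₁, e^{ε}c₂, c₃)`. -/
noncomputable def Cad (ε : ℝ) : ℝ × ℝ × ℝ → ℝ × ℝ × ℝ :=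
  fun c => (Real.exp (-ε) * c.1, Real.exp ε * c.2.1, c.2.2)

/-- `F` is a finite composition of adjoint maps from the families `A_ε`, `B_ε`, `C_ε`. -/
inductive IsAdjComp : ((ℝ × ℝ × ℝ) → (ℝ × ℝ × ℝ)) → Prop
  | id : IsAdjComp id
  | compA (ε : ℝ) {F : (ℝ × ℝ × ℝ) → (ℝ × ℝ × ℝ)} : IsAdjComp F → IsAdjComp (Aad ε ∘ F)
  | compB (ε : ℝ) {F : (ℝ × ℝ × ℝ) → (ℝ × ℝ × ℝ)} : IsAdjComp F → IsAdjComp (Bad ε ∘ F)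
  | compC (ε : ℝ) {F : (ℝ × ℝ × ℝ) → (ℝ × ℝ × ℝ)} : IsAdjComp F → IsAdjComp (Cad ε ∘ F)

/-- One-dimensional optimal system of the SPE symmetry algebra: every nonzero
`c = (c₁,c₂,c₃) ∈ ℝ³ ≅ 𝔤` can be mapped, by a finite composition of adjoint maps
and a nonzero rescaling, to `(1,a,0)`, `(b,1,0)`, or `(0,0,1)`; i.e. every
one-dimensional subalgebra is equivalent to one spanned by `v₁ + a v₂`,
`b v₁ + v₂`, or `v₃`. -/
theorem optimal_system_one_dimensional (c : ℝ × ℝ × ℝ) (hc : c ≠ 0) :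
    ∃ F : (ℝ × ℝ × ℝ) → (ℝ × ℝ × ℝ), IsAdjComp F ∧
      ∃ μ : ℝ, μ ≠ 0 ∧
        ((∃ a : ℝ, μ • F c = (1, a, 0)) ∨
         (∃ b : ℝ, μ • F c = (b, 1, 0)) ∨
         μ • F c = (0, 0, 1)) := by
  obtain ⟨x, y, z⟩ := c
  by_cases hz : z = 0
  · subst hz
    refine ⟨id, .id, ?_⟩
    by_cases hx : x = 0
    · subst hx
      have hy : y ≠ 0 := by
        rintro rfl
        exact hc rfl
      exact ⟨y⁻¹, inv_ne_zero hy, .inr (.inl ⟨0, by simp [hy]⟩)⟩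
    · exact ⟨x⁻¹, inv_ne_zero hx, .inl ⟨x⁻¹ * y, by simp [hx]⟩⟩
  · refine ⟨Aad (-x / z) ∘ Bad (-y / z) ∘ id, .compA _ (.compB _ .id), z⁻¹, inv_ne_zero hz,
      .inr (.inr ?_)⟩
    simp [Aad, Bad, hz]
end

section
/- Two-dimensional optimal system: let W ⊆ ℝ³ be any two-dimensional linear subspace that is closed under the bracket B (i.e. B(w, w') ∈ W for all w, w' ∈ W). Then there exists a finite composition F of adjoint maps from the families A_ε, B_ε, C_ε such that F(W) equals span{e₁, e₂}, span{e₁, e₃}, or span{e₂, e₃}, where e₁, e₂, e₃ is the standard basis of ℝ³. -/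
/-- The Lie bracket of `𝔤 ≅ ℝ³` in coordinates: it is the antisymmetric bilinear map
with `B(e₁,e₃) = e₁`, `B(e₂,e₃) = −e₂`, `B(e₁,e₂) = 0`. -/
def brkt (a b : ℝ × ℝ × ℝ) : ℝ × ℝ × ℝ :=
  (a.1 * b.2.2 - a.2.2 * b.1, -(a.2.1 * b.2.2 - a.2.2 * b.2.1), 0)

theorem linearIndependent_e₁_e₂ :
    LinearIndependent ℝ ![((1:ℝ), (0:ℝ), (0:ℝ)), ((0:ℝ), (1:ℝ), (0:ℝ))] := by
  rw [LinearIndependent.pair_iff]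
  intro s t h
  simpa using h

theorem span_pair_eq_of_finrank_eq_two {K V : Type*} [Field K] [AddCommGroup V] [Module K V]
    {W : Submodule K V} (hdim : Module.finrank K W = 2) {u v : V} (hu : u ∈ W) (hv : v ∈ W)
    (h : LinearIndependent K ![u, v]) : Submodule.span K {u, v} = W := by
  have : FiniteDimensional K W := Module.finite_of_finrank_pos (by omega)
  apply Submodule.eq_of_le_of_finrank_eq
  · rw [Submodule.span_le]
    rintro x (rfl | rfl) <;> assumption
  · have h2 := finrank_span_eq_card h
    rw [Matrix.range_cons, Matrix.range_cons, Matrix.range_empty, Set.union_empty,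
      Set.singleton_union] at h2
    rw [h2, hdim, Fintype.card_fin]

/-- A two-dimensional subspace containing a vector with nonzero third coordinate contains a vector
of the form `(a, b, 1)` and a nonzero vector of the form `(p, q, 0)`. -/
theorem exists_adapted_pair {W : Submodule ℝ (ℝ × ℝ × ℝ)} (hdim : Module.finrank ℝ W = 2)
    {w : ℝ × ℝ × ℝ} (hw : w ∈ W) (hw3 : w.2.2 ≠ 0) :
    ∃ a b p q : ℝ, (a, b, 1) ∈ W ∧ (p, q, 0) ∈ W ∧ (p ≠ 0 ∨ q ≠ 0) := by
  obtain ⟨x, hx, hxw⟩ : ∃ x ∈ W, x ∉ Submodule.span ℝ {w} := by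
    by_contra! h
    have h1 := Submodule.finrank_mono (show W ≤ Submodule.span ℝ {w} from h)
    have h2 : Module.finrank ℝ (Submodule.span ℝ {w}) ≤ 1 := by
      simpa using finrank_span_le_card (R := ℝ) {w}
    omega
  obtain ⟨w₁, w₂, w₃⟩ := w
  obtain ⟨x₁, x₂, x₃⟩ := x
  simp only at hw3
  refine ⟨w₃⁻¹ * w₁, w₃⁻¹ * w₂, x₁ - x₃ / w₃ * w₁, x₂ - x₃ / w₃ * w₂, ?_, ?_, ?_⟩
  · simpa [hw3] using W.smul_mem w₃⁻¹ hw
  · simpa [hw3] using W.sub_mem hx (W.smul_mem (x₃ / w₃) hw)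
  · by_contra! h
    refine hxw (Submodule.mem_span_singleton.2 ⟨x₃ / w₃, ?_⟩)
    simp only [Prod.smul_mk, smul_eq_mul, Prod.mk.injEq]
    exact ⟨by linarith [h.1], by linarith [h.2], by field_simp⟩

theorem image_Bad_span (a b : ℝ) :
    Bad (-b) '' (Submodule.span ℝ {((1:ℝ), (0:ℝ), (0:ℝ)), (a, b, (1:ℝ))} : Set (ℝ × ℝ × ℝ)) =
      (Submodule.span ℝ {((1:ℝ), (0:ℝ), (0:ℝ)), ((0:ℝ), (0:ℝ), (1:ℝ))} : Set (ℝ × ℝ × ℝ)) := by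
  ext ⟨x, y, z⟩
  simp only [Bad, Set.mem_image, SetLike.mem_coe, Submodule.mem_span_pair]
  constructor
  · rintro ⟨_, ⟨s, t, rfl⟩, h⟩
    refine ⟨s + t * a, t, ?_⟩
    simp at h ⊢
    grind
  · rintro ⟨s, t, h⟩
    refine ⟨_, ⟨s - t * a, t, rfl⟩, ?_⟩
    simp at h ⊢
    grind

theorem image_Aad_span (a b : ℝ) :
    Aad (-a) '' (Submodule.span ℝ {((0:ℝ), (1:ℝ), (0:ℝ)), (a, b, (1:ℝ))} : Set (ℝ × ℝ × ℝ)) =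
      (Submodule.span ℝ {((0:ℝ), (1:ℝ), (0:ℝ)), ((0:ℝ), (0:ℝ), (1:ℝ))} : Set (ℝ × ℝ × ℝ)) := by
  ext ⟨x, y, z⟩
  simp only [Aad, Set.mem_image, SetLike.mem_coe, Submodule.mem_span_pair]
  constructor
  · rintro ⟨_, ⟨s, t, rfl⟩, h⟩
    refine ⟨s + t * b, t, ?_⟩
    simp at h ⊢
    grind
  · rintro ⟨s, t, h⟩
    refine ⟨_, ⟨s - t * b, t, rfl⟩, ?_⟩
    simp at h ⊢
    grind

/-- Two-dimensional optimal system of the SPE symmetry algebra: every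
two-dimensional subspace of `𝔤 ≅ ℝ³` that is closed under the bracket can be
mapped by a finite composition of adjoint maps onto `span{e₁,e₂}`,
`span{e₁,e₃}`, or `span{e₂,e₃}`. -/
theorem optimal_system_two_dimensional (W : Submodule ℝ (ℝ × ℝ × ℝ))
    (hdim : Module.finrank ℝ W = 2)
    (hclosed : ∀ w ∈ W, ∀ w' ∈ W, brkt w w' ∈ W) :
    ∃ F : (ℝ × ℝ × ℝ) → (ℝ × ℝ × ℝ), IsAdjComp F ∧
      (F '' (W : Set (ℝ × ℝ × ℝ))
          = (Submodule.span ℝ {((1:ℝ), (0:ℝ), (0:ℝ)), ((0:ℝ), (1:ℝ), (0:ℝ))} : Set (ℝ × ℝ × ℝ)) ∨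
       F '' (W : Set (ℝ × ℝ × ℝ))
          = (Submodule.span ℝ {((1:ℝ), (0:ℝ), (0:ℝ)), ((0:ℝ), (0:ℝ), (1:ℝ))} : Set (ℝ × ℝ × ℝ)) ∨
       F '' (W : Set (ℝ × ℝ × ℝ))
          = (Submodule.span ℝ {((0:ℝ), (1:ℝ), (0:ℝ)), ((0:ℝ), (0:ℝ), (1:ℝ))} : Set (ℝ × ℝ × ℝ))) := by
  by_cases hplane : ∀ w ∈ W, w.2.2 = 0
  · refine ⟨id, .id, Or.inl ?_⟩
    have hle : W ≤ Submodule.span ℝ {((1:ℝ), (0:ℝ), (0:ℝ)), ((0:ℝ), (1:ℝ), (0:ℝ))} := by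
      rintro ⟨x, y, z⟩ hw
      obtain rfl : z = 0 := hplane _ hw
      exact Submodule.mem_span_pair.2 ⟨x, y, by simp⟩
    have hfin := finrank_span_eq_card linearIndependent_e₁_e₂
    rw [Matrix.range_cons, Matrix.range_cons, Matrix.range_empty, Set.union_empty,
      Set.singleton_union, Fintype.card_fin] at hfin
    rw [Set.image_id, Submodule.eq_of_le_of_finrank_eq hle (hdim.trans hfin.symm)]
  · push Not at hplane
    obtain ⟨w, hw, hw3⟩ := hplane
    obtain ⟨a, b, p, q, hab, hpq, hne⟩ := exists_adapted_pair hdim hw hw3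
    have hbr : (p, -q, 0) ∈ W := by simpa [brkt] using hclosed _ hpq _ hab
    have he₁ : p ≠ 0 → ((1:ℝ), (0:ℝ), (0:ℝ)) ∈ W := fun hp => by
      convert W.smul_mem (2 * p)⁻¹ (W.add_mem hpq hbr) using 1
      simp
      field_simp
      norm_num
    have he₂ : q ≠ 0 → ((0:ℝ), (1:ℝ), (0:ℝ)) ∈ W := fun hq => by
      convert W.smul_mem (2 * q)⁻¹ (W.sub_mem hpq hbr) using 1
      simp
      field_simp
      norm_num
    rcases hne with hp | hq
    · refine ⟨_, .compB (-b) .id, Or.inr (Or.inl ?_)⟩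
      rw [Function.comp_id, ← span_pair_eq_of_finrank_eq_two hdim (he₁ hp) hab, image_Bad_span]
      rw [LinearIndependent.pair_iff]
      intro s t h
      simp at h
      grind
    · refine ⟨_, .compA (-a) .id, Or.inr (Or.inr ?_)⟩
      rw [Function.comp_id, ← span_pair_eq_of_finrank_eq_two hdim (he₂ hq) hab, image_Aad_span]
      rw [LinearIndependent.pair_iff]
      intro s t h
      simp at h
      grind
end
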